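/- Suppose the VA algorithm V and candidate probbase q̂ ∈ (0,1)^{r×s} satisfy: for every block index ℓ, every k ∈ B_ℓ, and every answer vector α with P(A_{−ℓ} = α_{−ℓ}) > 0, F_k( V(α_{−ℓ}, q̂), q̂ ) = P(A_k = 1 | A_{−ℓ} = α_{−ℓ}). Then the pair (V, q̂) minimizes the imputation accuracy over all pairs: for every VA algorithm V' and every candidate probbase q' ∈ (0,1)^{r×s}, I^{V'}(q') ≥ I^V(q̂). -/

import Mathlib

open Classical
noncomputable section

/-- An answer to a verbal autopsy question: `some true` = "1" (yes),
`some false` = "0" (no), `none` = "NA" (missing). -/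
abbrev Ans := Option Bool

/-- Probability of an event `E` under a probability mass function `P`
on a finite sample space `Ω`. -/
def pr {Ω : Type*} [Fintype Ω] (P : Ω → ℝ) (E : Ω → Prop) : ℝ :=
  ∑ ω, if E ω then P ω else 0

/-- Conditional probability `P(E | F) = P(E ∧ F) / P(F)`. -/
def cpr {Ω : Type*} [Fintype Ω] (P : Ω → ℝ) (E F : Ω → Prop) : ℝ :=
  pr P (fun ω => E ω ∧ F ω) / pr P F

/-- The answer vector `α` with every entry in block `ℓ` replaced by `NA`;
this is `α₋ℓ`. -/
def mask {s b : ℕ} (B : Fin s → Fin b) (ℓ : Fin b) (α : Fin s → Ans) : Fin s → Ans :=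
  fun k => if B k = ℓ then none else α k

/-- The event `{A₋ℓ = α₋ℓ}`: all answers outside block `ℓ` agree with `α`. -/
def maskEv {r s b : ℕ} (B : Fin s → Fin b) (ℓ : Fin b) (α : Fin s → Ans) :
    (Fin s → Ans) × Fin r → Prop :=
  fun ω => ∀ m, B m ≠ ℓ → ω.1 m = α m

/-- `F_k(pih, qh) = Σ_j pih_j qh_{jk}`. -/
def Fk {r s : ℕ} (k : Fin s) (pih : Fin r → ℝ) (qh : Fin r → Fin s → ℝ) : ℝ :=
  ∑ j, pih j * qh j k

/-- Cross-entropy loss `L(ŷ, y) = -(y log ŷ + (1-y) log(1-ŷ))`. -/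
def loss (yh y : ℝ) : ℝ := -(y * Real.log yh + (1 - y) * Real.log (1 - yh))

/-- A candidate probbase has all entries in the open interval (0,1). -/
def isProbbase {r s : ℕ} (qh : Fin r → Fin s → ℝ) : Prop :=
  ∀ j k, qh j k ∈ Set.Ioo (0 : ℝ) 1

/-- A VA algorithm maps an answer vector and a candidate probbase to a
probability vector over causes of death (an element of the simplex Δ_r). -/
def isVA {r s : ℕ} (V : (Fin s → Ans) → (Fin r → Fin s → ℝ) → Fin r → ℝ) : Prop :=
  ∀ (a : Fin s → Ans) (qh : Fin r → Fin s → ℝ), isProbbase qh →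
    (∀ j, 0 ≤ V a qh j) ∧ (∑ j, V a qh j) = 1

/-- The true probbase: `q_{jk} = P(A_k = 1 | D = j)`. -/
def trueQ {r s : ℕ} (P : (Fin s → Ans) × Fin r → ℝ) : Fin r → Fin s → ℝ :=
  fun j k => cpr P (fun ω => ω.1 k = some true) (fun ω => ω.2 = j)

/-- Assumption 1 (blockwise conditional independence): the blocks of answers
are mutually conditionally independent given the cause of death `D`. -/
def Assump1 {r s b : ℕ} (P : (Fin s → Ans) × Fin r → ℝ) (B : Fin s → Fin b) : Prop :=
  ∀ (j : Fin r) (α : Fin s → Ans),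
    cpr P (fun ω => ω.1 = α) (fun ω => ω.2 = j)
      = ∏ ℓ : Fin b, cpr P (fun ω => ∀ m, B m = ℓ → ω.1 m = α m) (fun ω => ω.2 = j)

/-- Imputation accuracy `I^V(qh) = E[L(F_K(V(A₋B(K), qh), qh), 1{A_K = 1})]`,
where `K` is uniform on questions and independent of `A`. -/
def impAcc {r s b : ℕ} (P : (Fin s → Ans) × Fin r → ℝ) (B : Fin s → Fin b)
    (V : (Fin s → Ans) → (Fin r → Fin s → ℝ) → Fin r → ℝ)
    (qh : Fin r → Fin s → ℝ) : ℝ :=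
  (1 / (s : ℝ)) * ∑ k : Fin s, ∑ α : Fin s → Ans,
    pr P (fun ω => ω.1 = α) *
      loss (Fk k (V (mask B (B k) α) qh) qh) (if α k = some true then 1 else 0)

/-- Empirical imputation accuracy `I_𝒜(qh)` over a dataset of `n` answer vectors. -/
def impAccEmp {r s b : ℕ} (n : ℕ) (B : Fin s → Fin b)
    (V : (Fin s → Ans) → (Fin r → Fin s → ℝ) → Fin r → ℝ)
    (qh : Fin r → Fin s → ℝ) (a : Fin n → Fin s → Ans) : ℝ :=
  (1 / ((n : ℝ) * (s : ℝ))) * ∑ i : Fin n, ∑ k : Fin s,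
    loss (Fk k (V (mask B (B k) (a i)) qh) qh) (if a i k = some true then 1 else 0)

/-- `i_α(qh) = Σ_k L(F_k(V(α₋B(k), qh), qh), 1{α_k = 1})`. -/
def iAlpha {r s b : ℕ} (B : Fin s → Fin b)
    (V : (Fin s → Ans) → (Fin r → Fin s → ℝ) → Fin r → ℝ)
    (qh : Fin r → Fin s → ℝ) (α : Fin s → Ans) : ℝ :=
  ∑ k : Fin s, loss (Fk k (V (mask B (B k) α) qh) qh) (if α k = some true then 1 else 0)

lemma aux_pos {r : ℕ} (p q : Fin r → ℝ) (h0 : ∀ j, 0 ≤ p j) (h1 : ∑ j, p j = 1)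
    (hq : ∀ j, 0 < q j) : 0 < ∑ j, p j * q j := by
  have hnn : ∀ j ∈ Finset.univ, 0 ≤ p j * q j := fun j _ => mul_nonneg (h0 j) (hq j).le
  rcases (Finset.sum_nonneg hnn).lt_or_eq with h | h
  · exact h
  · exfalso
    have h2 := (Finset.sum_eq_zero_iff_of_nonneg hnn).1 h.symm
    have h3 : ∑ j, p j = 0 := Finset.sum_eq_zero fun j hj => by
      rcases mul_eq_zero.1 (h2 j hj) with h | h
      · exact h
      · exact absurd h (hq j).ne'
    linarith

lemma Fk_mem {r s : ℕ} (V : (Fin s → Ans) → (Fin r → Fin s → ℝ) → Fin r → ℝ)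
    (hV : isVA V) (q : Fin r → Fin s → ℝ) (hq : isProbbase q) (a : Fin s → Ans) (k : Fin s) :
    0 < Fk k (V a q) q ∧ Fk k (V a q) q < 1 := by
  obtain ⟨h0, h1⟩ := hV a q hq
  refine ⟨aux_pos _ (fun j => q j k) h0 h1 fun j => (hq j k).1, ?_⟩
  have := aux_pos _ (fun j => 1 - q j k) h0 h1 fun j => sub_pos.2 (hq j k).2
  simp only [mul_sub, mul_one, Finset.sum_sub_distrib, h1] at this
  unfold Fk
  linarith

lemma gibbs (x y : ℝ) (hx : 0 < x) (hx1 : x < 1) (hy : 0 < y) (hy1 : y < 1) :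
    x * Real.log y + (1 - x) * Real.log (1 - y)
      ≤ x * Real.log x + (1 - x) * Real.log (1 - x) := by
  have key : ∀ u v : ℝ, 0 < u → 0 < v → u * Real.log v - u * Real.log u ≤ v - u := by
    intro u v hu hv
    have h := Real.log_le_sub_one_of_pos (div_pos hv hu)
    rw [Real.log_div hv.ne' hu.ne'] at h
    have h2 := mul_le_mul_of_nonneg_left h hu.le
    have h3 : u * (v / u - 1) = v - u := by field_simp
    linarith
  have a := key x y hx hy
  have b := key (1 - x) (1 - y) (by linarith) (by linarith)
  linarith

lemma pr_eq {Ω : Type*} [Fintype Ω] (P : Ω → ℝ) (E : Ω → Prop) [DecidablePred E] :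
    pr P E = ∑ ω, if E ω then P ω else 0 := by
  unfold pr
  refine Finset.sum_congr rfl fun ω _ => ?_
  split_ifs <;> rfl

lemma pr_fst {r s : ℕ} (P : (Fin s → Ans) × Fin r → ℝ) (G : (Fin s → Ans) → Prop)
    [DecidablePred G] :
    pr P (fun ω => G ω.1) = ∑ α, if G α then pr P (fun ω => ω.1 = α) else 0 := by
  simp_rw [pr_eq]
  have : ∀ α : Fin s → Ans, (if G α then ∑ ω : (Fin s → Ans) × Fin r,
      (if ω.1 = α then P ω else 0) else 0)
      = ∑ ω : (Fin s → Ans) × Fin r, if ω.1 = α then (if G ω.1 then P ω else 0) else 0 := by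
    intro α
    split_ifs with h
    · refine Finset.sum_congr rfl fun ω _ => ?_
      by_cases e : ω.1 = α
      · simp [e, h]
      · simp [e]
    · symm
      refine Finset.sum_eq_zero fun ω _ => ?_
      by_cases e : ω.1 = α
      · simp [e, h]
      · simp [e]
  simp_rw [this]
  rw [Finset.sum_comm]
  simp

lemma mask_eq_iff {s b : ℕ} (B : Fin s → Fin b) (ℓ : Fin b) (α β : Fin s → Ans) :
    mask B ℓ α = mask B ℓ β ↔ ∀ m, B m ≠ ℓ → α m = β m := by
  constructor
  · intro h m hm
    have := congrFun h m
    simpa [mask, hm] using this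
  · intro h
    funext m
    by_cases hm : B m = ℓ
    · simp [mask, hm]
    · simp [mask, hm, h m hm]

lemma sum_loss {ι : Type*} (S : Finset ι) (w : ι → ℝ) (G : ι → Prop) [DecidablePred G] (x : ℝ) :
    ∑ α ∈ S, w α * loss x (if G α then 1 else 0)
      = -((∑ α ∈ S, if G α then w α else 0) * Real.log x
        + ((∑ α ∈ S, w α) - ∑ α ∈ S, if G α then w α else 0) * Real.log (1 - x)) := by
  rw [← Finset.sum_sub_distrib, Finset.sum_mul, Finset.sum_mul, ← Finset.sum_add_distrib,
    ← Finset.sum_neg_distrib]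
  refine Finset.sum_congr rfl fun α _ => ?_
  unfold loss
  split_ifs <;> ring

/-- Lemma 2 of the paper. If the pair `(V, qh)` imputes
correctly, i.e. `F_k(V(α₋ℓ, qh), qh) = P(A_k = 1 | A₋ℓ = α₋ℓ)` for every
block `ℓ`, every `k ∈ B_ℓ` and every `α` with `P(A₋ℓ = α₋ℓ) > 0`, then
`(V, qh)` minimises the imputation accuracy over all pairs. -/
theorem statement4 {r s b : ℕ} (hr : 0 < r) (hs : 0 < s) (hb : 0 < b)
    (P : (Fin s → Ans) × Fin r → ℝ)
    (hP0 : ∀ ω, 0 ≤ P ω) (hP1 : ∑ ω, P ω = 1)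
    (B : Fin s → Fin b) (hB : Function.Surjective B)
    (V : (Fin s → Ans) → (Fin r → Fin s → ℝ) → Fin r → ℝ)
    (hV : isVA V)
    (qh : Fin r → Fin s → ℝ) (hqh : isProbbase qh)
    (hcal : ∀ (ℓ : Fin b) (k : Fin s), B k = ℓ → ∀ α : Fin s → Ans,
      0 < pr P (maskEv B ℓ α) →
      Fk k (V (mask B ℓ α) qh) qh
        = cpr P (fun ω => ω.1 k = some true) (maskEv B ℓ α))
    (V' : (Fin s → Ans) → (Fin r → Fin s → ℝ) → Fin r → ℝ)
    (hV' : isVA V')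
    (q' : Fin r → Fin s → ℝ) (hq' : isProbbase q') :
    impAcc P B V qh ≤ impAcc P B V' q' := by
  unfold impAcc
  refine mul_le_mul_of_nonneg_left ?_ (by positivity)
  refine Finset.sum_le_sum fun k _ => ?_
  rw [← Finset.sum_fiberwise Finset.univ (mask B (B k)),
    ← Finset.sum_fiberwise Finset.univ (mask B (B k)) (fun α => pr P (fun ω => ω.1 = α) *
      loss (Fk k (V' (mask B (B k) α) q') q') (if α k = some true then 1 else 0))]
  refine Finset.sum_le_sum fun β _ => ?_
  by_cases hβ : ∃ α, mask B (B k) α = β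
  swap
  · have : Finset.univ.filter (fun α => mask B (B k) α = β) = ∅ := by
      ext α
      simp only [Finset.mem_filter, Finset.mem_univ, true_and, Finset.notMem_empty, iff_false]
      exact fun h => hβ ⟨α, h⟩
    simp [this]
  obtain ⟨α₀, rfl⟩ := hβ
  have conv : ∀ (U : (Fin s → Ans) → (Fin r → Fin s → ℝ) → Fin r → ℝ) (q : Fin r → Fin s → ℝ),
      ∑ α with mask B (B k) α = mask B (B k) α₀, pr P (fun ω => ω.1 = α) *
        loss (Fk k (U (mask B (B k) α) q) q) (if α k = some true then 1 else 0)
      = ∑ α with mask B (B k) α = mask B (B k) α₀, pr P (fun ω => ω.1 = α) *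
        loss (Fk k (U (mask B (B k) α₀) q) q) (if α k = some true then 1 else 0) := by
    intro U q
    refine Finset.sum_congr rfl fun α hα => ?_
    rw [(Finset.mem_filter.1 hα).2]
  rw [conv V qh, conv V' q']
  rw [sum_loss _ _ (fun α : Fin s → Ans => α k = some true),
    sum_loss _ _ (fun α : Fin s → Ans => α k = some true)]
  have hW : pr P (maskEv B (B k) α₀)
      = ∑ α with mask B (B k) α = mask B (B k) α₀, pr P (fun ω => ω.1 = α) := by
    rw [Finset.sum_filter]
    simp_rw [mask_eq_iff]
    exact pr_fst P (fun α => ∀ m, B m ≠ B k → α m = α₀ m)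
  have hW1 : pr P (fun ω => ω.1 k = some true ∧ maskEv B (B k) α₀ ω)
      = ∑ α with mask B (B k) α = mask B (B k) α₀,
        if α k = some true then pr P (fun ω => ω.1 = α) else 0 := by
    rw [Finset.sum_filter]
    simp_rw [mask_eq_iff]
    refine (pr_fst P (fun α => α k = some true ∧ ∀ m, B m ≠ B k → α m = α₀ m)).trans ?_
    refine Finset.sum_congr rfl fun α _ => ?_
    by_cases h1 : α k = some true <;> by_cases h2 : ∀ m, B m ≠ B k → α m = α₀ m <;>
      simp only [h1, h2, if_true, if_false, and_true, and_false, true_and, false_and] <;> simp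
  have hw : ∀ E : (Fin s → Ans) × Fin r → Prop, 0 ≤ pr P E := by
    intro E
    refine Finset.sum_nonneg fun ω _ => ?_
    split_ifs
    · exact hP0 ω
    · exact le_rfl
  have hle : pr P (fun ω => ω.1 k = some true ∧ maskEv B (B k) α₀ ω)
      ≤ pr P (maskEv B (B k) α₀) := by
    refine Finset.sum_le_sum fun ω _ => ?_
    have := hP0 ω
    by_cases h1 : ω.1 k = some true <;> by_cases h2 : maskEv B (B k) α₀ ω <;> simp [h1, h2, this]
  rw [← hW, ← hW1]
  have hc := hcal (B k) k rfl α₀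
  obtain ⟨hx, hx1⟩ := Fk_mem V hV qh hqh (mask B (B k) α₀) k
  obtain ⟨hy, hy1⟩ := Fk_mem V' hV' q' hq' (mask B (B k) α₀) k
  unfold cpr at hc
  have h1 := hw (fun ω => ω.1 k = some true ∧ maskEv B (B k) α₀ ω)
  have h2 := hw (maskEv B (B k) α₀)
  generalize pr P (fun ω => ω.1 k = some true ∧ maskEv B (B k) α₀ ω) = W1 at *
  generalize pr P (maskEv B (B k) α₀) = W at *
  generalize Fk k (V (mask B (B k) α₀) qh) qh = x at *
  generalize Fk k (V' (mask B (B k) α₀) q') q' = y at *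
  rcases h2.lt_or_eq with h | h
  · have e : W1 = W * x := by
      rw [hc h]
      field_simp
    have g := mul_le_mul_of_nonneg_left (gibbs x y hx hx1 hy hy1) h2
    rw [e]
    linarith
  · have e : W1 = 0 := by linarith
    simp [e, ← h]
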